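/- (Doeblin's theorem: unique invariant measure and geometric rate of convergence.) Let (X, 𝔅) be a measurable space and let P̄ be a Markov kernel on X. Suppose there exist β ∈ (0, 1] and a probability measure φ on X such that P̄(x, A) ≥ β · φ(A) for every x ∈ X and every A ∈ 𝔅. Then P̄ has a unique invariant probability measure π, and for every probability measure μ₀ on X and every n ≥ 1, sup over A ∈ 𝔅 of |(μ₀ P̄^n)(A) − π(A)| ≤ (1 − β)^n, where μ₀ P̄^n denotes the distribution after n steps of the chain with kernel P̄ started from μ₀. -/

import Mathlib

open MeasureTheory Set
open scoped ENNReal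

/-- The distribution of a Markov chain with kernel `P` after `n` steps, started
from the initial distribution `μ₀`. -/
noncomputable def stepIter {X : Type*} [MeasurableSpace X]
    (P : ProbabilityTheory.Kernel X X) (n : ℕ) (μ₀ : Measure X) : Measure X :=
  (fun μ => μ.bind (fun x => P x))^[n] μ₀

section ConstantPart

open ProbabilityTheory

variable {X : Type*} [MeasurableSpace X]

lemma stepIter_succ (κ : Kernel X X) (n : ℕ) (μ : Measure X) :
    stepIter κ (n + 1) μ = (stepIter κ n μ).bind κ :=
  Function.iterate_succ_apply' _ n μ

lemma bind_kernel_apply (κ : Kernel X X) (μ : Measure X) {A : Set X} (hA : MeasurableSet A) :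
    μ.bind κ A = ∫⁻ x, κ x A ∂μ :=
  Measure.bind_apply hA κ.aemeasurable

lemma bind_sum_measure {ι : Type*} (κ : Kernel X X) (μ : ι → Measure X) :
    (Measure.sum μ).bind κ = Measure.sum fun i => (μ i).bind κ := by
  ext A hA
  simp only [bind_kernel_apply _ _ hA, lintegral_sum_measure, Measure.sum_apply _ hA]

instance isProbabilityMeasure_stepIter (κ : Kernel X X) [IsMarkovKernel κ] (n : ℕ)
    (μ : Measure X) [IsProbabilityMeasure μ] : IsProbabilityMeasure (stepIter κ n μ) := by
  induction n with
  | zero => assumption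
  | succ n ih =>
    refine ⟨?_⟩
    simp [stepIter_succ, bind_kernel_apply _ _ MeasurableSet.univ]

lemma stepIter_apply_univ {κ : Kernel X X} {r : ℝ≥0∞} (hκ : ∀ x, κ x univ = r) (n : ℕ)
    (μ : Measure X) : stepIter κ n μ univ = r ^ n * μ univ := by
  induction n with
  | zero => simp [stepIter]
  | succ n ih =>
    simp only [stepIter_succ, bind_kernel_apply _ _ MeasurableSet.univ, hκ, lintegral_const, ih]
    ring

/-- The kernel `κ` with a common finite part `ν` of all its measures removed. -/
noncomputable def residualKernel (κ : Kernel X X) (ν : Measure X) [IsFiniteMeasure ν]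
    (h : ∀ x, ν ≤ κ x) : Kernel X X where
  toFun x := κ x - ν
  measurable' := Measure.measurable_of_measurable_coe _ fun A hA => by
    simp_rw [Measure.sub_apply hA (h _)]
    exact (κ.measurable_coe hA).sub_const _

lemma add_residualKernel_apply (κ : Kernel X X) (ν : Measure X) [IsFiniteMeasure ν]
    (h : ∀ x, ν ≤ κ x) (x : X) : κ x = ν + residualKernel κ ν h x := by
  rw [add_comm]
  exact (Measure.sub_add_cancel_of_le (h x)).symm

lemma residualKernel_apply_univ (κ : Kernel X X) [IsMarkovKernel κ] (ν : Measure X)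
    [IsFiniteMeasure ν] (h : ∀ x, ν ≤ κ x) (x : X) :
    residualKernel κ ν h x univ = 1 - ν univ := by
  change (κ x - ν) univ = _
  rw [Measure.sub_apply MeasurableSet.univ (h x), measure_univ]

variable {κ ρ : Kernel X X} {ν : Measure X}

lemma bind_eq_add_bind (hκ : ∀ x, κ x = ν + ρ x) (μ : Measure X) [IsProbabilityMeasure μ] :
    μ.bind κ = ν + μ.bind ρ := by
  ext A hA
  simp [bind_kernel_apply _ _ hA, hκ, lintegral_add_left]

lemma add_bind_sum_stepIter (ρ : Kernel X X) (ν : Measure X) :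
    ν + (Measure.sum fun n => stepIter ρ n ν).bind ρ = Measure.sum fun n => stepIter ρ n ν := by
  ext A hA
  rw [bind_sum_measure, Measure.add_apply, Measure.sum_apply _ hA, Measure.sum_apply _ hA,
    tsum_eq_zero_add' (f := fun n => stepIter ρ n ν A) ENNReal.summable]
  simp_rw [stepIter_succ]
  rfl

lemma stepIter_eq_sum_add (hκ : ∀ x, κ x = ν + ρ x) [IsMarkovKernel κ] (μ : Measure X)
    [IsProbabilityMeasure μ] (n : ℕ) :
    stepIter κ n μ = ∑ k ∈ Finset.range n, stepIter ρ k ν + stepIter ρ n μ := by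
  induction n with
  | zero => simp [stepIter]
  | succ n ih =>
    have hsum : (∑ k ∈ Finset.range n, stepIter ρ k ν + stepIter ρ n μ).bind ρ
        = ∑ k ∈ Finset.range n, stepIter ρ (k + 1) ν + stepIter ρ (n + 1) μ := by
      ext A hA
      simp [stepIter_succ, bind_kernel_apply _ _ hA]
    rw [stepIter_succ, bind_eq_add_bind hκ, ih, hsum, Finset.sum_range_succ', ← add_assoc]
    congr 1
    exact add_comm _ _

/-- Two chains run with the same kernel `κ = ν + ρ`, where all `ρ x` have mass `r`, are within
`r ^ n` of each other in total variation after `n` steps. -/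
lemma abs_stepIter_sub_stepIter_le (hκ : ∀ x, κ x = ν + ρ x) [IsMarkovKernel κ] {r : ℝ}
    (hr : 0 ≤ r) (hρ : ∀ x, ρ x univ = ENNReal.ofReal r) (μ μ' : Measure X)
    [IsProbabilityMeasure μ] [IsProbabilityMeasure μ'] (n : ℕ) (A : Set X) :
    |(stepIter κ n μ A).toReal - (stepIter κ n μ' A).toReal| ≤ r ^ n := by
  have le_pow (m : Measure X) [IsProbabilityMeasure m] :
      stepIter ρ n m A ≤ ENNReal.ofReal (r ^ n) := by
    refine (measure_mono (subset_univ A)).trans_eq ?_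
    rw [stepIter_apply_univ hρ, measure_univ, mul_one, ENNReal.ofReal_pow hr]
  have ne_top (m : Measure X) [IsProbabilityMeasure m] : stepIter ρ n m A ≠ ∞ :=
    ((le_pow m).trans_lt ENNReal.ofReal_lt_top).ne
  have common_ne_top : (∑ k ∈ Finset.range n, stepIter ρ k ν) A ≠ ∞ := by
    have h := measure_ne_top (stepIter κ n μ) A
    rw [stepIter_eq_sum_add hκ, Measure.add_apply] at h
    exact (ENNReal.add_ne_top.1 h).1
  rw [stepIter_eq_sum_add hκ μ, stepIter_eq_sum_add hκ μ', Measure.add_apply, Measure.add_apply,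
    ENNReal.toReal_add common_ne_top (ne_top μ), ENNReal.toReal_add common_ne_top (ne_top μ'),
    add_sub_add_left_eq_sub]
  exact abs_sub_le_of_nonneg_of_le ENNReal.toReal_nonneg
    (ENNReal.toReal_le_of_le_ofReal (pow_nonneg hr n) (le_pow μ)) ENNReal.toReal_nonneg
    (ENNReal.toReal_le_of_le_ofReal (pow_nonneg hr n) (le_pow μ'))

lemma stepIter_of_invariant {μ : Measure X} (h : κ.Invariant μ) (n : ℕ) :
    stepIter κ n μ = μ :=
  Function.iterate_fixed (f := fun m : Measure X => m.bind κ) h n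

lemma invariant_iff_forall_apply_eq_lintegral {μ : Measure X} :
    κ.Invariant μ ↔ ∀ A, MeasurableSet A → μ A = ∫⁻ x, κ x A ∂μ := by
  refine ⟨fun h A hA => ?_, fun h => ?_⟩
  · rw [← bind_kernel_apply κ μ hA, h.def]
  · ext A hA
    rw [bind_kernel_apply κ μ hA, h A hA]

end ConstantPart

/-- **Doeblin's theorem.** If a Markov kernel `P̄` on a measurable space
satisfies the Doeblin minorization `P̄(x, A) ≥ β φ(A)` for some `β ∈ (0,1]` and a probability
measure `φ`, then `P̄` has a unique invariant probability measure `π`, and for every initial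
probability measure `μ₀` and `n ≥ 1`, `sup_A |(μ₀ P̄^n)(A) − π(A)| ≤ (1 − β)^n`. -/
theorem doeblin_unique_invariant_and_geometric_convergence
    {X : Type*} [MeasurableSpace X]
    (Pbar : ProbabilityTheory.Kernel X X) [ProbabilityTheory.IsMarkovKernel Pbar]
    (β : ℝ) (hβ0 : 0 < β) (hβ1 : β ≤ 1)
    (φ : Measure X) (hφ : IsProbabilityMeasure φ)
    (hDoeblin : ∀ x : X, ∀ A : Set X, MeasurableSet A →
      ENNReal.ofReal β * φ A ≤ Pbar x A) :
    ∃ π : Measure X,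
      (IsProbabilityMeasure π ∧
        ∀ A : Set X, MeasurableSet A → π A = ∫⁻ x, Pbar x A ∂π) ∧
      (∀ π' : Measure X, IsProbabilityMeasure π' →
        (∀ A : Set X, MeasurableSet A → π' A = ∫⁻ x, Pbar x A ∂π') → π' = π) ∧
      (∀ μ₀ : Measure X, IsProbabilityMeasure μ₀ → ∀ n : ℕ, 1 ≤ n →
        ∀ A : Set X, MeasurableSet A →
          |((stepIter Pbar n μ₀) A).toReal - (π A).toReal| ≤ (1 - β) ^ n) := by
  have hν (x : X) : β.toNNReal • φ ≤ Pbar x :=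
    Measure.le_iff.2 fun A hA => hDoeblin x A hA
  set ν : Measure X := β.toNNReal • φ
  set ρ := residualKernel Pbar ν hν
  have hP (x : X) : Pbar x = ν + ρ x := add_residualKernel_apply Pbar ν hν x
  have hν_univ : ν univ = ENNReal.ofReal β := by
    change ENNReal.ofReal β * φ univ = _
    rw [measure_univ, mul_one]
  have hρ (x : X) : ρ x univ = ENNReal.ofReal (1 - β) := by
    rw [residualKernel_apply_univ, hν_univ, ENNReal.ofReal_sub 1 hβ0.le, ENNReal.ofReal_one]
  have hr : 0 ≤ 1 - β := sub_nonneg.2 hβ1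
  set π : Measure X := Measure.sum fun n => stepIter ρ n ν
  have hπ : IsProbabilityMeasure π := by
    refine ⟨?_⟩
    simp_rw [π, Measure.sum_apply _ MeasurableSet.univ, stepIter_apply_univ hρ, hν_univ]
    rw [ENNReal.tsum_mul_right, ENNReal.tsum_geometric, ← ENNReal.ofReal_one,
      ← ENNReal.ofReal_sub 1 hr, sub_sub_cancel, ENNReal.ofReal_one]
    exact ENNReal.inv_mul_cancel (ENNReal.ofReal_pos.2 hβ0).ne' ENNReal.ofReal_ne_top
  have hinv : Pbar.Invariant π := (bind_eq_add_bind hP π).trans (add_bind_sum_stepIter ρ ν)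
  have hconv (μ : Measure X) [IsProbabilityMeasure μ] (n : ℕ) (A : Set X) :
      |(stepIter Pbar n μ A).toReal - (π A).toReal| ≤ (1 - β) ^ n := by
    simpa only [stepIter_of_invariant hinv] using
      abs_stepIter_sub_stepIter_le hP hr hρ μ π n A
  refine ⟨π, ⟨hπ, invariant_iff_forall_apply_eq_lintegral.1 hinv⟩, fun π' hπ' h => ?_,
    fun μ₀ _ n _ A _ => hconv μ₀ n A⟩
  have hinv' : Pbar.Invariant π' := invariant_iff_forall_apply_eq_lintegral.2 h
  ext A
  have hle : |(π' A).toReal - (π A).toReal| ≤ 0 :=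
    ge_of_tendsto' (tendsto_pow_atTop_nhds_zero_of_lt_one hr (by linarith)) fun n => by
      simpa only [stepIter_of_invariant hinv'] using hconv π' n A
  rw [← ENNReal.toReal_eq_toReal_iff' (measure_ne_top π' A) (measure_ne_top π A)]
  exact sub_eq_zero.1 (abs_nonpos_iff.1 hle)
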